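/- arXiv:math/0504537 — 2 statements merged into one kernel-verified Lean document; each statement's English description precedes it below -/
import Mathlib

section
/- Let A be a commutative ring with no zero divisors that is graded by the additive monoid ℤ^n × ℕ, and let C(A) = {λ ∈ ℚ^n : there exists an integer r > 0 with r·λ ∈ ℤ^n and A_{(r·λ, r)} ≠ 0}. Then C(A) is ℚ-convex: for all λ, μ ∈ C(A) and all t ∈ ℚ with 0 ≤ t ≤ 1, the point t·λ + (1−t)·μ belongs to C(A). -/
/-- In a domain graded by a monoid, the degrees with nonzero component are closed under
nonnegative integer combinations. -/
theorem gradedComponent_nsmul_add_nsmul_ne_bot {M A : Type*} [AddMonoid M] [CommRing A]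
    [NoZeroDivisors A] (𝒜 : M → AddSubgroup A) [SetLike.GradedMonoid 𝒜] {i j : M}
    (hi : 𝒜 i ≠ ⊥) (hj : 𝒜 j ≠ ⊥) (a b : ℕ) : 𝒜 (a • i + b • j) ≠ ⊥ := by
  obtain ⟨f, hf, hf0⟩ := (𝒜 i).bot_or_exists_ne_zero.resolve_left hi
  obtain ⟨g, hg, hg0⟩ := (𝒜 j).bot_or_exists_ne_zero.resolve_left hj
  intro h
  have hmem : f ^ a * g ^ b ∈ 𝒜 (a • i + b • j) :=
    SetLike.mul_mem_graded (SetLike.pow_mem_graded a hf) (SetLike.pow_mem_graded b hg)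
  rw [h, AddSubgroup.mem_bot] at hmem
  exact mul_ne_zero (pow_ne_zero a hf0) (pow_ne_zero b hg0) hmem


/-- **ℚ-convexity of the set of rational weights of a graded domain.**
Let `A` be a commutative ring with no zero divisors graded by `ℤ^n × ℕ`, and let
`C(A) = {λ ∈ ℚ^n : ∃ r > 0, r•λ ∈ ℤ^n and A_{(r•λ, r)} ≠ 0}`.  Then `C(A)` is
ℚ-convex. -/
theorem qConvex_of_gradedDomain {n : ℕ} {A : Type*} [CommRing A] [NoZeroDivisors A]
    (𝒜 : (Fin n → ℤ) × ℕ → AddSubgroup A) [GradedRing 𝒜]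
    (C : Set (Fin n → ℚ))
    (hC : C = {lam : Fin n → ℚ | ∃ r : ℕ, 0 < r ∧ ∃ μ : Fin n → ℤ,
      (∀ i, (r : ℚ) * lam i = (μ i : ℚ)) ∧ 𝒜 (μ, r) ≠ ⊥})
    (lam mu : Fin n → ℚ) (hlam : lam ∈ C) (hmu : mu ∈ C)
    (t : ℚ) (ht0 : 0 ≤ t) (ht1 : t ≤ 1) :
    t • lam + (1 - t) • mu ∈ C := by
  subst hC
  obtain ⟨r, hr, ν, hν, hr0⟩ := hlam
  obtain ⟨s, hs, ξ, hξ, hs0⟩ := hmu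
  obtain ⟨p, hp⟩ := Int.eq_ofNat_of_zero_le (Rat.num_nonneg.mpr ht0)
  have hq : (0 : ℚ) < t.den := by exact_mod_cast t.den_pos
  have htq : t * t.den = p := by
    rw [Rat.mul_den_eq_num, hp]
    rfl
  have hpq : p ≤ t.den := by
    have : (p : ℚ) ≤ t.den := by nlinarith
    exact_mod_cast this
  obtain ⟨k, hk⟩ := Nat.exists_eq_add_of_le hpq
  have hkq : (t.den : ℚ) = p + k := by exact_mod_cast hk
  have hne := gradedComponent_nsmul_add_nsmul_ne_bot 𝒜 hr0 hs0 (p * s) (k * r)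
  refine ⟨t.den * r * s, Nat.mul_pos (Nat.mul_pos t.den_pos hr) hs,
    (p * s) • ν + (k * r) • ξ, fun i => ?_, ?_⟩
  · rw [Pi.add_apply, Pi.smul_apply, Pi.smul_apply, Pi.add_apply, Pi.smul_apply, Pi.smul_apply]
    simp only [smul_eq_mul, nsmul_eq_mul]
    push_cast
    rw [← hν i, ← hξ i]
    linear_combination (r * s * (lam i - mu i)) * htq + (r * s * mu i) * hkq
  · convert hne using 2
    ext i
    · rfl
    · simp only [Prod.snd_add, Prod.smul_snd, smul_eq_mul, hk]
      ring
end

section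
/- Let A be a commutative ring with no zero divisors that is graded by the additive monoid ℤ^n × ℕ, and suppose A is generated as an algebra over its degree-(0,0) component by nonzero homogeneous elements a_1, …, a_k with a_i ∈ A_{(λ_i, r_i)} and r_i ≥ 1 for each i. Let C(A) = {λ ∈ ℚ^n : there exists an integer r > 0 with r·λ ∈ ℤ^n and A_{(r·λ, r)} ≠ 0}. Then C(A) equals the ℚ-convex hull of the finite set {λ_1/r_1, …, λ_k/r_k} in ℚ^n, i.e. the set of all sums Σ t_i (λ_i/r_i) with t_i ∈ ℚ, t_i ≥ 0 and Σ t_i = 1. In particular C(A) is a convex polytope over ℚ. -/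
/-- Finitely many nonnegative rationals have a common positive denominator. -/
theorem exists_nat_mul_eq_natCast {ι : Type*} [Fintype ι] (q : ι → ℚ) (hq : ∀ i, 0 ≤ q i) :
    ∃ D : ℕ, 0 < D ∧ ∃ p : ι → ℕ, ∀ i, (p i : ℚ) = D * q i := by
  refine ⟨∏ i, (q i).den, Finset.prod_pos fun i _ => (q i).den_pos, ?_⟩
  suffices h : ∀ i, ∃ p : ℕ, (p : ℚ) = ((∏ i, (q i).den : ℕ) : ℚ) * q i by
    choose p hp using h
    exact ⟨p, hp⟩
  intro i
  obtain ⟨c, hc⟩ := Finset.dvd_prod_of_mem (fun i => (q i).den) (Finset.mem_univ i)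
  obtain ⟨m, hm⟩ := Int.eq_ofNat_of_zero_le (Rat.num_nonneg.2 (hq i))
  refine ⟨c * m, ?_⟩
  have h := Rat.den_mul_eq_num (q i)
  rw [hm] at h
  rw [hc]
  push_cast at h ⊢
  rw [← h]
  ring

/-- If a graded ring is generated over its degree-zero component by homogeneous elements of
degrees `d i`, then every degree with nonzero component is a natural combination of the `d i`. -/
theorem exists_sum_nsmul_eq_of_ne_bot {ι κ A : Type*} [AddCommMonoid ι] [DecidableEq ι]
    [Fintype κ] [CommRing A] (𝒜 : ι → AddSubgroup A) [GradedRing 𝒜] {a : κ → A} {d : κ → ι}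
    (ha : ∀ i, a i ∈ 𝒜 (d i))
    (hgen : Subring.closure ((𝒜 0 : Set A) ∪ Set.range a) = ⊤) {e : ι} (he : 𝒜 e ≠ ⊥) :
    ∃ m : κ → ℕ, e = ∑ i, m i • d i := by
  classical
  obtain ⟨y, hy, hy0⟩ := (AddSubgroup.bot_or_exists_ne_zero (𝒜 e)).resolve_left he
  by_contra hne
  have hmon : ∀ x ∈ Submonoid.closure ((𝒜 0 : Set A) ∪ Set.range a),
      ∃ m : κ → ℕ, x ∈ 𝒜 (∑ i, m i • d i) := by
    intro x hx
    induction hx using Submonoid.closure_induction with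
    | mem x hx =>
      rcases hx with hx | ⟨i, rfl⟩
      · exact ⟨0, by simpa using hx⟩
      · exact ⟨Pi.single i 1, by simpa [Pi.single_apply, ite_smul] using ha i⟩
    | one => exact ⟨0, by simpa using SetLike.GradedOne.one_mem (A := 𝒜)⟩
    | mul x y _ _ hx hy =>
      obtain ⟨m, hm⟩ := hx
      obtain ⟨m', hm'⟩ := hy
      exact ⟨m + m', by
        simpa [add_smul, Finset.sum_add_distrib] using SetLike.GradedMul.mul_mem hm hm'⟩
  have key : ∀ x ∈ AddSubgroup.closure
      (Submonoid.closure ((𝒜 0 : Set A) ∪ Set.range a) : Set A),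
      (DirectSum.decompose 𝒜 x e : A) = 0 := by
    intro x hx
    induction hx using AddSubgroup.closure_induction with
    | mem x hx =>
      obtain ⟨m, hm⟩ := hmon x hx
      exact DirectSum.decompose_of_mem_ne 𝒜 hm fun h => hne ⟨m, h.symm⟩
    | zero => simp
    | add x y _ _ hx hy => simp [hx, hy]
    | neg x _ hx =>
      rw [DirectSum.decompose_neg]
      exact (congrArg Neg.neg hx).trans neg_zero
  have hyc := key y (Subring.mem_closure_iff.1 (hgen ▸ Subring.mem_top y))
  rw [DirectSum.decompose_of_mem_same 𝒜 hy] at hyc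
  exact hy0 hyc

/-- For a finitely generated graded domain `A` (graded by `ℤ^n × ℕ`) with homogeneous
generators `a i ∈ A_{(λ i, r i)}`, `r i ≥ 1`, the set
`C(A) = {λ ∈ ℚ^n : ∃ r > 0, r•λ ∈ ℤ^n and A_{(r•λ, r)} ≠ 0}` equals the ℚ-convex hull
of the points `λ i / r i`, i.e. the set of rational convex combinations of these points. -/
theorem qConvexHull_of_generated_gradedDomain {n : ℕ} {A : Type*} [CommRing A]
    [NoZeroDivisors A]
    (𝒜 : (Fin n → ℤ) × ℕ → AddSubgroup A) [GradedRing 𝒜]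
    {k : ℕ} (a : Fin k → A) (lam : Fin k → Fin n → ℤ) (r : Fin k → ℕ)
    (ha0 : ∀ i, a i ≠ 0) (ha : ∀ i, a i ∈ 𝒜 (lam i, r i)) (hr : ∀ i, 1 ≤ r i)
    (hgen : Subring.closure ((𝒜 (0, 0) : Set A) ∪ Set.range a) = ⊤)
    (C : Set (Fin n → ℚ))
    (hC : C = {x : Fin n → ℚ | ∃ s : ℕ, 0 < s ∧ ∃ μ : Fin n → ℤ,
      (∀ i, (s : ℚ) * x i = (μ i : ℚ)) ∧ 𝒜 (μ, s) ≠ ⊥}) :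
    C = {x : Fin n → ℚ | ∃ t : Fin k → ℚ, (∀ i, 0 ≤ t i) ∧ ∑ i, t i = 1 ∧
      x = ∑ i, t i • ((r i : ℚ)⁻¹ • fun j => (lam i j : ℚ))} := by
  subst hC
  ext x
  simp only [Set.mem_ofPred_eq]
  constructor
  · rintro ⟨s, hs, μ, hx, hne⟩
    obtain ⟨m, hm⟩ := exists_sum_nsmul_eq_of_ne_bot 𝒜 (d := fun i => (lam i, r i)) ha hgen hne
    have hμ : μ = ∑ i, m i • lam i := by simpa [Prod.fst_sum] using congrArg Prod.fst hm
    have hsum : s = ∑ i, m i * r i := by simpa [Prod.snd_sum] using congrArg Prod.snd hm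
    have hs0 : (s : ℚ) ≠ 0 := by positivity
    refine ⟨fun i => m i * r i / s, fun i => by positivity, ?_, ?_⟩
    · rw [← Finset.sum_div, div_eq_one_iff_eq hs0, hsum]
      push_cast
      rfl
    · ext j
      apply mul_left_cancel₀ hs0
      rw [hx j, hμ]
      simp only [Finset.sum_apply, Pi.smul_apply, smul_eq_mul, nsmul_eq_mul, Finset.mul_sum]
      push_cast
      refine Finset.sum_congr rfl fun i _ => ?_
      have hr0 : (r i : ℚ) ≠ 0 := by have := hr i; positivity
      simp
      field_simp
  · rintro ⟨t, ht, hsum, rfl⟩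
    obtain ⟨D, hD, p, hp⟩ := exists_nat_mul_eq_natCast (fun i => t i * (r i : ℚ)⁻¹)
      fun i => mul_nonneg (ht i) (by positivity)
    refine ⟨D, hD, ∑ i, p i • lam i, fun j => ?_, ?_⟩
    · simp only [Finset.sum_apply, Pi.smul_apply, smul_eq_mul, nsmul_eq_mul, Finset.mul_sum]
      push_cast
      refine Finset.sum_congr rfl fun i _ => ?_
      simp [hp]
      ring
    · have hdeg : ((∑ i, p i • lam i, D) : (Fin n → ℤ) × ℕ) = ∑ i, p i • (lam i, r i) := by
        refine Prod.ext (by simp [Prod.fst_sum]) ?_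
        simp only [Prod.snd_sum, Prod.smul_snd, smul_eq_mul]
        have h : (D : ℚ) = ∑ i, (p i : ℚ) * r i := by
          rw [← mul_one (D : ℚ), ← hsum, Finset.mul_sum]
          refine Finset.sum_congr rfl fun i _ => ?_
          have hr0 : (r i : ℚ) ≠ 0 := by have := hr i; positivity
          rw [hp]
          field_simp
        exact_mod_cast h
      have hmem : ∏ i, a i ^ p i ∈ 𝒜 (∑ i, p i • (lam i, r i)) :=
        SetLike.prod_mem_graded _ _ _ fun i _ => SetLike.pow_mem_graded _ (ha i)
      have hk : Nonempty (Fin k) := by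
        by_contra h
        rw [not_nonempty_iff] at h
        simp at hsum
      have : Nontrivial A := nontrivial_of_ne _ _ (ha0 hk.some)
      intro hbot
      rw [← hdeg, hbot, AddSubgroup.mem_bot] at hmem
      exact Finset.prod_ne_zero_iff.2 (fun i _ => pow_ne_zero _ (ha0 i)) hmem
end
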